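/- arXiv:1509.04622 — 2 statements merged into one kernel-verified Lean document; each statement's English description precedes it below -/
import Mathlib

section
/- Let b > 0 and let D be a nonempty open subset of the torus T(1,b) that is homeomorphic to the open unit disk of ℝ². Then its ground state energy satisfies λ(D) > π²/b². -/
open Real MeasureTheory Set

noncomputable section

/-- The flat torus `T(a,b) = (ℝ/aℤ) × (ℝ/bℤ)`. -/
abbrev Torus (a b : ℝ) := AddCircle a × AddCircle b

/-- The canonical projection `ℝ² → T(a,b)`. -/
def torusProj (a b : ℝ) (p : ℝ × ℝ) : Torus a b :=
  ((p.1 : AddCircle a), (p.2 : AddCircle b))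

/-- Squared Euclidean norm of the gradient of `f : ℝ² → ℝ` at `p`. -/
def gradSq (f : ℝ × ℝ → ℝ) (p : ℝ × ℝ) : ℝ :=
  (fderiv ℝ f p (1, 0)) ^ 2 + (fderiv ℝ f p (0, 1)) ^ 2

/-- A fundamental domain for the torus `T(a,b)` inside `ℝ²`. -/
def Fund (a b : ℝ) : Set (ℝ × ℝ) := Ioc 0 a ×ˢ Ioc 0 b

/-- The Rayleigh quotient `∫ |∇u|² / ∫ u²` of a function `u` on the torus `T(a,b)`,
computed by lifting `u` to `ℝ²` and integrating over a fundamental domain. -/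
def RayleighT (a b : ℝ) (u : Torus a b → ℝ) : ℝ :=
  (∫ p in Fund a b, gradSq (fun q => u (torusProj a b q)) p) /
    (∫ p in Fund a b, (u (torusProj a b p)) ^ 2)

/-- `u` is an admissible (test) function for the Dirichlet ground state energy of
`D ⊆ T(a,b)`: it is smooth (i.e. its lift to `ℝ²` is `C^∞`), nonzero, and its support is
a compact subset of `D`. -/
def IsTest (a b : ℝ) (D : Set (Torus a b)) (u : Torus a b → ℝ) : Prop :=
  ContDiff ℝ (⊤ : ℕ∞) (fun q : ℝ × ℝ => u (torusProj a b q)) ∧ u ≠ 0 ∧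
    IsCompact (tsupport u) ∧ tsupport u ⊆ D

/-- The ground state energy `λ(D)` of an open set `D ⊆ T(a,b)`:
the infimum of Rayleigh quotients over test functions supported in `D`. -/
def groundEnergy (a b : ℝ) (D : Set (Torus a b)) : ℝ :=
  sInf {r | ∃ u : Torus a b → ℝ, IsTest a b D u ∧ r = RayleighT a b u}

/-- A `k`-partition of the torus `T(a,b)`: a `k`-tuple of pairwise disjoint nonempty
open subsets. -/
def IsPartitionT (a b : ℝ) {k : ℕ} (D : Fin k → Set (Torus a b)) : Prop :=
  (∀ i, IsOpen (D i)) ∧ (∀ i, (D i).Nonempty) ∧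
    ∀ i j, i ≠ j → Disjoint (D i) (D j)

/-- The energy `Λ(𝒟) = max_j λ(D_j)` of a partition. -/
def energyT (a b : ℝ) {k : ℕ} (D : Fin k → Set (Torus a b)) : ℝ :=
  ⨆ i, groundEnergy a b (D i)

/-- The minimal partition energy `𝔏_k(T(a,b))`. -/
def minEnergyT (a b : ℝ) (k : ℕ) : ℝ :=
  sInf {E | ∃ D : Fin k → Set (Torus a b), IsPartitionT a b D ∧ E = energyT a b D}

/-- The circle is not a retract of a simply connected space. -/
theorem AddCircle.not_leftInverse_of_simplyConnected {X : Type*} [TopologicalSpace X]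
    [SimplyConnectedSpace X] [LocallyPathConnectedSpace X] {b : ℝ} (hb : b ≠ 0)
    (f : C(X, AddCircle b)) (g : C(AddCircle b, X)) : ¬ Function.LeftInverse f g := by
  intro hfg
  obtain ⟨F, ⟨-, hF⟩, -⟩ := (AddCircle.isCoveringMap_coe b).existsUnique_continuousMap_lifts f
    (g 0) 0 (by rw [hfg]; simp)
  have hs (z : AddCircle b) : ((F (g z) : ℝ) : AddCircle b) = z := (congrFun hF (g z)).trans (hfg z)
  have hcont : Continuous fun t : ℝ => F (g (t : AddCircle b)) - t :=
    (F.continuous.comp (g.continuous.comp (AddCircle.continuous_mk' b))).sub continuous_id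
  have hint (t : ℝ) : ∃ n : ℤ, n • b = F (g (t : AddCircle b)) - t := by
    rw [← AddCircle.coe_eq_zero_iff, AddCircle.coe_sub, hs, sub_self]
  choose n hn using hint
  have hncont : Continuous n := by
    have h : Continuous fun t : ℝ => (n t : ℝ) := by
      have : (fun t : ℝ => (n t : ℝ)) = fun t : ℝ => (F (g (t : AddCircle b)) - t) / b := by
        funext t
        rw [← hn t, zsmul_eq_mul, mul_div_cancel_right₀ _ hb]
      rw [this]
      exact hcont.div_const b
    exact Int.isClosedEmbedding_coe_real.isEmbedding.continuous_iff.2 h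
  have hconst : n b = n 0 := PreconnectedSpace.constant inferInstance hncont
  have h0 := hn 0
  have h1 := hn b
  rw [hconst, h0, AddCircle.coe_period, QuotientAddGroup.mk_zero] at h1
  exact hb (by linarith)

/-- Wirtinger's inequality with Dirichlet boundary values and a constant below the optimal one. -/
theorem integral_deriv_sq_sub_nonneg_of_mul_lt_pi {f : ℝ → ℝ} (hf : ContDiff ℝ 1 f) {b c k : ℝ}
    (hb : 0 < b) (hk : 0 ≤ k) (hkb : k * b < π) (hc : f c = 0) (hcb : f (c + b) = 0) :
    0 ≤ ∫ x in c..c + b, ((deriv f x) ^ 2 - k ^ 2 * (f x) ^ 2) := by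
  set m := c + b / 2
  have hd (x : ℝ) : HasDerivAt f (deriv f x) x := (hf.differentiable one_ne_zero x).hasDerivAt
  have hf'c : Continuous (deriv f) := hf.continuous_deriv le_rfl
  have hfc : Continuous f := hf.continuous
  have hcos : ∀ x ∈ uIcc c (c + b), cos (k * (x - m)) ≠ 0 := by
    intro x hx
    rw [uIcc_of_le (by linarith)] at hx
    refine (cos_pos_of_mem_Ioo ⟨?_, ?_⟩).ne' <;> simp only [m] <;>
      nlinarith [mul_nonneg hk (sub_nonneg.2 hx.1), mul_nonneg hk (sub_nonneg.2 hx.2)]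
  have htan : ContinuousOn (fun x => tan (k * (x - m))) (uIcc c (c + b)) := by
    intro x hx
    have hlin : ContinuousAt (fun x => k * (x - m)) x := by fun_prop
    exact (ContinuousAt.comp (f := fun x => k * (x - m)) (continuousAt_tan.2 (hcos x hx))
      hlin).continuousWithinAt
  set g' : ℝ → ℝ := fun x => 2 * k * f x * deriv f x * tan (k * (x - m)) +
    k ^ 2 * (f x) ^ 2 * (1 + tan (k * (x - m)) ^ 2) with hg'
  have hg'c : ContinuousOn g' (uIcc c (c + b)) := by
    have h1 := hfc.continuousOn (s := uIcc c (c + b))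
    have h2 := hf'c.continuousOn (s := uIcc c (c + b))
    fun_prop
  have hg : ∀ x ∈ uIcc c (c + b),
      HasDerivAt (fun x => k * (f x) ^ 2 * tan (k * (x - m))) (g' x) x := by
    intro x hx
    have h1 : HasDerivAt (fun x => k * (x - m)) k x := by
      simpa using ((hasDerivAt_id x).sub_const m).const_mul k
    have h2 := (hasDerivAt_tan (hcos x hx)).comp x h1
    have h3 := (((hd x).pow 2).const_mul k).mul h2
    refine h3.congr_deriv ?_
    have h4 : 1 / cos (k * (x - m)) ^ 2 = 1 + tan (k * (x - m)) ^ 2 := by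
      rw [one_div, ← inv_one_add_tan_sq (hcos x hx), inv_inv]
    simp only [hg', h4, Function.comp, Pi.pow_apply]
    push_cast
    ring
  have hint := intervalIntegral.integral_eq_sub_of_hasDerivAt hg hg'c.intervalIntegrable
  simp only [hc, hcb] at hint
  have hint0 : ∫ x in c..c + b, g' x = 0 := by rw [hint]; ring
  have hq : Continuous fun x => (deriv f x) ^ 2 - k ^ 2 * (f x) ^ 2 := by fun_prop
  have hsum := intervalIntegral.integral_add (hq.intervalIntegrable (μ := volume) c (c + b))
    hg'c.intervalIntegrable
  rw [hint0, add_zero] at hsum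
  rw [← hsum]
  refine intervalIntegral.integral_nonneg (by linarith) fun x _ => ?_
  have : (deriv f x) ^ 2 - k ^ 2 * (f x) ^ 2 + g' x
      = (deriv f x + k * f x * tan (k * (x - m))) ^ 2 := by
    simp only [hg']; ring
  rw [this]
  positivity

/-- Wirtinger's inequality for periodic functions with a zero. -/
theorem Function.Periodic.integral_deriv_sq_sub_nonneg {f : ℝ → ℝ} (hf : ContDiff ℝ 1 f) {b c : ℝ}
    (hb : 0 < b) (hper : Function.Periodic f b) (hc : f c = 0) :
    0 ≤ ∫ x in (0 : ℝ)..b, ((deriv f x) ^ 2 - (π / b) ^ 2 * (f x) ^ 2) := by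
  have hf'c : Continuous (deriv f) := hf.continuous_deriv le_rfl
  have hfc : Continuous f := hf.continuous
  have hf'2 : Continuous fun x => (deriv f x) ^ 2 := hf'c.pow 2
  have hf2 (k : ℝ) : Continuous fun x => k * (f x) ^ 2 := by fun_prop
  have hper' : Function.Periodic (deriv f) b := fun x => by
    rw [← deriv_comp_add_const, funext hper]
  have key (k : ℝ) (hk : k ∈ Ioo 0 (π / b)) :
      0 ≤ (∫ x in (0 : ℝ)..b, (deriv f x) ^ 2) - k ^ 2 * ∫ x in (0 : ℝ)..b, (f x) ^ 2 := by
    have h := integral_deriv_sq_sub_nonneg_of_mul_lt_pi hf hb hk.1.le ((lt_div_iff₀ hb).1 hk.2) hc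
      (by rw [hper, hc])
    have hq : Function.Periodic (fun x => (deriv f x) ^ 2 - k ^ 2 * (f x) ^ 2) b := fun x => by
      simp only [hper x, hper' x]
    rw [hq.intervalIntegral_add_eq c 0, zero_add, intervalIntegral.integral_sub
      (hf'2.intervalIntegrable _ _)
      ((hf2 _).intervalIntegrable _ _),
      intervalIntegral.integral_const_mul] at h
    exact h
  have hpos : 0 < π / b := div_pos pi_pos hb
  rw [intervalIntegral.integral_sub (hf'2.intervalIntegrable _ _)
      ((hf2 _).intervalIntegrable _ _), intervalIntegral.integral_const_mul]
  have hcl : π / b ∈ closure (Ioo 0 (π / b)) := by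
    rw [closure_Ioo hpos.ne]
    exact right_mem_Icc.2 hpos.le
  have hkc : Continuous fun k : ℝ =>
      (∫ x in (0 : ℝ)..b, (deriv f x) ^ 2) - k ^ 2 * ∫ x in (0 : ℝ)..b, (f x) ^ 2 := by fun_prop
  exact closure_minimal key (isClosed_le continuous_const hkc) hcl

theorem Continuous.integrableOn_Fund {f : ℝ × ℝ → ℝ} (hf : Continuous f) (a b : ℝ) :
    IntegrableOn f (Fund a b) :=
  (hf.continuousOn.integrableOn_compact (isCompact_Icc.prod isCompact_Icc)).mono_set
    (prod_mono Ioc_subset_Icc_self Ioc_subset_Icc_self)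

/-- Fibrewise Wirtinger inequality in the second variable. -/
theorem mul_integral_sq_le_integral_fderiv_snd_sq {G : ℝ × ℝ → ℝ} (hG : ContDiff ℝ 1 G) (a : ℝ)
    {b : ℝ} (hb : 0 < b) (hper : ∀ x, Function.Periodic (fun y => G (x, y)) b)
    (hzero : ∀ x, ∃ y, G (x, y) = 0) :
    (π / b) ^ 2 * ∫ p in Fund a b, (G p) ^ 2 ≤ ∫ p in Fund a b, (fderiv ℝ G p (0, 1)) ^ 2 := by
  have hGc : Continuous G := hG.continuous
  have hG'c : Continuous fun p => fderiv ℝ G p (0, 1) :=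
    (hG.continuous_fderiv one_ne_zero).clm_apply continuous_const
  have hq : Continuous fun p => (fderiv ℝ G p (0, 1)) ^ 2 - (π / b) ^ 2 * (G p) ^ 2 := by fun_prop
  have hnn : 0 ≤ ∫ p in Fund a b, ((fderiv ℝ G p (0, 1)) ^ 2 - (π / b) ^ 2 * (G p) ^ 2) := by
    rw [Fund, Measure.volume_eq_prod, setIntegral_prod _ (hq.integrableOn_Fund a b)]
    refine integral_nonneg fun x => ?_
    have hsec : ContDiff ℝ 1 fun y => G (x, y) := hG.comp (by fun_prop)
    have hder (y : ℝ) : deriv (fun y => G (x, y)) y = fderiv ℝ G (x, y) (0, 1) :=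
      ((hG.differentiable one_ne_zero (x, y)).hasFDerivAt.comp_hasDerivAt y
        ((hasDerivAt_const y x).prodMk (hasDerivAt_id y))).deriv
    obtain ⟨c, hc⟩ := hzero x
    have h := Function.Periodic.integral_deriv_sq_sub_nonneg hsec hb (hper x) hc
    simp only [hder] at h
    rwa [intervalIntegral.integral_of_le hb.le] at h
  have hG'2 : Continuous fun p => (fderiv ℝ G p (0, 1)) ^ 2 := hG'c.pow 2
  have hG2 : Continuous fun p => (π / b) ^ 2 * (G p) ^ 2 := by fun_prop
  rw [integral_sub (hG'2.integrableOn_Fund a b) (hG2.integrableOn_Fund a b),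
    integral_const_mul] at hnn
  linarith

/-- Poincaré's inequality for a doubly periodic function on `ℝ²` that vanishes somewhere on every
horizontal and every vertical line. -/
theorem mul_integral_sq_le_integral_gradSq {F : ℝ × ℝ → ℝ} (hF : ContDiff ℝ 1 F)
    {a b : ℝ} (ha : 0 < a) (hb : 0 < b)
    (hper₁ : ∀ y, Function.Periodic (fun x => F (x, y)) a)
    (hper₂ : ∀ x, Function.Periodic (fun y => F (x, y)) b)
    (hzero₁ : ∀ y, ∃ x, F (x, y) = 0) (hzero₂ : ∀ x, ∃ y, F (x, y) = 0) :
    ((π / a) ^ 2 + (π / b) ^ 2) * ∫ p in Fund a b, (F p) ^ 2 ≤ ∫ p in Fund a b, gradSq F p := by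
  have hv := mul_integral_sq_le_integral_fderiv_snd_sq hF a hb hper₂ hzero₂
  have hswap : ContDiff ℝ 1 fun p : ℝ × ℝ => F p.swap := hF.comp (contDiff_snd.prodMk contDiff_fst)
  have hh := mul_integral_sq_le_integral_fderiv_snd_sq hswap b ha hper₁ hzero₁
  have hder (p : ℝ × ℝ) : fderiv ℝ (fun p : ℝ × ℝ => F p.swap) p (0, 1)
      = fderiv ℝ F p.swap (1, 0) := by
    have h := (hF.differentiable one_ne_zero p.swap).hasFDerivAt.comp p
      ((ContinuousLinearEquiv.prodComm ℝ ℝ ℝ).hasFDerivAt (x := p))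
    exact (congrArg (fun L : ℝ × ℝ →L[ℝ] ℝ => L (0, 1)) h.fderiv).trans (by simp)
  simp only [hder] at hh
  simp only [Fund, Measure.volume_eq_prod] at hh hv ⊢
  rw [setIntegral_prod_swap _ _ (fun p => F p ^ 2),
    setIntegral_prod_swap _ _ (fun p => (fderiv ℝ F p (1, 0)) ^ 2)] at hh
  have hc (v : ℝ × ℝ) : Continuous fun p => (fderiv ℝ F p v) ^ 2 :=
    ((hF.continuous_fderiv one_ne_zero).clm_apply continuous_const).pow 2
  have hsum := integral_add ((hc (1, 0)).integrableOn_Fund a b) ((hc (0, 1)).integrableOn_Fund a b)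
  simp only [Fund, Measure.volume_eq_prod] at hsum
  unfold gradSq
  rw [hsum]
  linarith

theorem exists_mem_Fund_torusProj_eq {a b : ℝ} (ha : 0 < a) (hb : 0 < b) (z : Torus a b) :
    ∃ p ∈ Fund a b, torusProj a b p = z := by
  have := Fact.mk ha
  have := Fact.mk hb
  have h1 : z.1 ∈ ((↑) : ℝ → AddCircle a) '' Ioc 0 (0 + a) := by
    rw [AddCircle.coe_image_Ioc_eq]; trivial
  have h2 : z.2 ∈ ((↑) : ℝ → AddCircle b) '' Ioc 0 (0 + b) := by
    rw [AddCircle.coe_image_Ioc_eq]; trivial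
  obtain ⟨x, hx, hxz⟩ := h1
  obtain ⟨y, hy, hyz⟩ := h2
  rw [zero_add] at hx hy
  exact ⟨(x, y), ⟨hx, hy⟩, Prod.ext hxz hyz⟩

theorem integral_sq_pos_of_ne_zero {a b : ℝ} (ha : 0 < a) (hb : 0 < b) {u : Torus a b → ℝ}
    (hu : Continuous fun q => u (torusProj a b q)) (hne : u ≠ 0) :
    0 < ∫ p in Fund a b, (u (torusProj a b p)) ^ 2 := by
  refine (integral_nonneg fun p => sq_nonneg _).lt_of_ne fun h => hne ?_
  rw [eq_comm, integral_eq_zero_iff_of_nonneg (fun p => sq_nonneg _)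
    ((hu.pow 2).integrableOn_Fund a b)] at h
  have hcl : Fund a b ⊆ closure (interior (Fund a b)) := by
    rw [Fund, interior_prod_eq, interior_Ioc, interior_Ioc, closure_prod_eq, closure_Ioo ha.ne,
      closure_Ioo hb.ne]
    exact prod_mono Ioc_subset_Icc_self Ioc_subset_Icc_self
  have heq := Measure.eqOn_of_ae_eq h (hu.pow 2).continuousOn continuousOn_const hcl
  funext z
  obtain ⟨p, hp, rfl⟩ := exists_mem_Fund_torusProj_eq ha hb z
  exact pow_eq_zero_iff two_ne_zero |>.1 (heq hp)

theorem exists_smooth_nonneg_eq_zero_iff {b : ℝ} (hb : 0 < b) (z₀ : AddCircle b) :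
    ∃ f : AddCircle b → ℝ, Continuous f ∧ ContDiff ℝ (⊤ : ℕ∞) (fun t : ℝ => f (t : AddCircle b)) ∧
      (∀ z, 0 ≤ f z) ∧ ∀ z, f z = 0 ↔ z = z₀ := by
  obtain ⟨t₀, rfl⟩ := QuotientAddGroup.mk_surjective z₀
  have hper : Function.Periodic (fun t : ℝ => 1 - cos (2 * π / b * (t - t₀))) b := fun t => by
    have : 2 * π / b * (t + b - t₀) = 2 * π / b * (t - t₀) + 2 * π := by field_simp; ring
    simp only [this, cos_add_two_pi]
  refine ⟨hper.lift, ?_, ?_, ?_, ?_⟩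
  · refine (QuotientAddGroup.isQuotientMap_mk _).continuous_iff.2 ?_
    change Continuous fun t : ℝ => 1 - cos (2 * π / b * (t - t₀))
    fun_prop
  · change ContDiff ℝ _ fun t : ℝ => 1 - cos (2 * π / b * (t - t₀))
    exact contDiff_const.sub (contDiff_cos.comp (by fun_prop))
  · intro z
    obtain ⟨t, rfl⟩ := QuotientAddGroup.mk_surjective z
    exact sub_nonneg.2 (cos_le_one _)
  · intro z
    obtain ⟨t, rfl⟩ := QuotientAddGroup.mk_surjective z
    change 1 - cos (2 * π / b * (t - t₀)) = 0 ↔ (t : AddCircle b) = (t₀ : AddCircle b)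
    rw [sub_eq_zero, eq_comm, cos_eq_one_iff, ← sub_eq_zero, ← AddCircle.coe_sub,
      AddCircle.coe_eq_zero_iff]
    refine exists_congr fun n => ?_
    rw [zsmul_eq_mul]
    have := pi_pos.ne'
    field_simp

theorem exists_isTest {a b : ℝ} (ha : 0 < a) (hb : 0 < b) {D : Set (Torus a b)} (hD : IsOpen D)
    (hne : D.Nonempty) : ∃ u, IsTest a b D u := by
  have := Fact.mk ha
  have := Fact.mk hb
  obtain ⟨z₀, hz₀⟩ := hne
  obtain ⟨f, hfc, hfs, hf0, hf⟩ := exists_smooth_nonneg_eq_zero_iff ha z₀.1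
  obtain ⟨g, hgc, hgs, hg0, hg⟩ := exists_smooth_nonneg_eq_zero_iff hb z₀.2
  have hφc : Continuous fun z : Torus a b => f z.1 + g z.2 := by fun_prop
  obtain ⟨ε, hε, hεD⟩ : ∃ ε > 0, ∀ z : Torus a b, f z.1 + g z.2 ≤ ε → z ∈ D := by
    rcases Dᶜ.eq_empty_or_nonempty with h | h
    · exact ⟨1, one_pos, fun z _ => by rw [compl_empty_iff.1 h]; trivial⟩
    · obtain ⟨w, hw, hmin⟩ := hD.isClosed_compl.isCompact.exists_isMinOn h hφc.continuousOn
      have hpos : 0 < f w.1 + g w.2 := by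
        refine (add_nonneg (hf0 _) (hg0 _)).lt_of_ne fun h0 => hw ?_
        have h1 : f w.1 = 0 := by linarith [hf0 w.1, hg0 w.2]
        have h2 : g w.2 = 0 := by linarith [hf0 w.1, hg0 w.2]
        have : w = z₀ := Prod.ext ((hf _).1 h1) ((hg _).1 h2)
        rwa [this]
      refine ⟨(f w.1 + g w.2) / 2, half_pos hpos, fun z hz => ?_⟩
      by_contra hzD
      have : f w.1 + g w.2 ≤ f z.1 + g z.2 := hmin hzD
      linarith
  have hsub : tsupport (fun z : Torus a b => smoothTransition (ε - (f z.1 + g z.2)))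
      ⊆ {z | f z.1 + g z.2 ≤ ε} := by
    refine closure_minimal (fun z hz => ?_) (isClosed_le hφc continuous_const)
    by_contra hlt
    exact hz (smoothTransition.zero_of_nonpos (sub_nonpos.2 (not_le.1 hlt).le))
  refine ⟨fun z => smoothTransition (ε - (f z.1 + g z.2)), ?_, ?_,
    (isClosed_tsupport _).isCompact, fun z hz => hεD z (hsub hz)⟩
  · exact smoothTransition.contDiff.comp
      (contDiff_const.sub ((hfs.comp contDiff_fst).add (hgs.comp contDiff_snd)))
  · intro h
    have h0 := congrFun h z₀
    simp only [(hf _).2 rfl, (hg _).2 rfl, add_zero, sub_zero] at h0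
    exact (smoothTransition.pos_of_pos hε).ne' h0

/-- A subset of a space over the circle that is homeomorphic to a ball contains no section. -/
theorem exists_notMem_of_homeomorph_ball {Y : Type*} [TopologicalSpace Y] {D : Set Y}
    {E : Type*} [NormedAddCommGroup E] [NormedSpace ℝ E] {r : ℝ} (hr : 0 < r)
    (e : D ≃ₜ Metric.ball (0 : E) r) {b : ℝ} (hb : b ≠ 0) {p : Y → AddCircle b}
    (hp : Continuous p) {s : AddCircle b → Y} (hs : Continuous s) (hps : Function.LeftInverse p s) :
    ∃ z, s z ∉ D := by
  by_contra! h
  have := (convex_ball (0 : E) r).contractibleSpace (Metric.nonempty_ball.2 hr)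
  have : LocallyPathConnectedSpace (Metric.ball (0 : E) r) :=
    Metric.isOpen_ball.locallyPathConnectedSpace
  refine AddCircle.not_leftInverse_of_simplyConnected hb
    (⟨fun x => p (e.symm x), by fun_prop⟩ : C(Metric.ball (0 : E) r, AddCircle b))
    ⟨fun z => e ⟨s z, h z⟩, by fun_prop⟩ fun z => ?_
  simpa using hps z

/-- If `D` is a nonempty open subset of `T(1,b)` homeomorphic to the open
unit disk of `ℝ²`, then `λ(D) > π²/b²`. -/
theorem statement3 (b : ℝ) (hb : 0 < b) (D : Set (Torus 1 b)) (hD : IsOpen D)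
    (hne : D.Nonempty)
    (hhom : Nonempty (↥D ≃ₜ ↥(Metric.ball (0 : EuclideanSpace ℝ (Fin 2)) 1))) :
    π ^ 2 / b ^ 2 < groundEnergy 1 b D := by
  obtain ⟨e⟩ := hhom
  have hbound : (π / 1) ^ 2 + (π / b) ^ 2 ≤ groundEnergy 1 b D := by
    obtain ⟨u₀, hu₀⟩ := exists_isTest one_pos hb hD hne
    refine le_csInf ⟨_, u₀, hu₀, rfl⟩ ?_
    rintro _ ⟨u, ⟨hsmooth, hu0, -, hsupp⟩, rfl⟩
    have hvanish (z : Torus 1 b) (hz : z ∉ D) : u z = 0 :=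
      image_eq_zero_of_notMem_tsupport fun h => hz (hsupp h)
    rw [RayleighT, le_div_iff₀ (integral_sq_pos_of_ne_zero one_pos hb hsmooth.continuous hu0)]
    refine mul_integral_sq_le_integral_gradSq (hsmooth.of_le (mod_cast le_top)) one_pos hb
      (fun y x => ?_) (fun x y => ?_) (fun y => ?_) fun x => ?_
    · simp only [torusProj, AddCircle.coe_add_period]
    · simp only [torusProj, AddCircle.coe_add_period]
    · obtain ⟨z, hz⟩ := exists_notMem_of_homeomorph_ball one_pos e one_ne_zero continuous_fst
        (s := fun z => (z, (y : AddCircle b))) (by fun_prop) fun _ => rfl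
      obtain ⟨x, rfl⟩ := QuotientAddGroup.mk_surjective z
      exact ⟨x, hvanish _ hz⟩
    · obtain ⟨z, hz⟩ := exists_notMem_of_homeomorph_ball one_pos e hb.ne' continuous_snd
        (s := fun z => ((x : AddCircle (1 : ℝ)), z)) (by fun_prop) fun _ => rfl
      obtain ⟨y, rfl⟩ := QuotientAddGroup.mk_surjective z
      exact ⟨y, hvanish _ hz⟩
  rw [← div_pow]
  have : 0 < (π / 1) ^ 2 := by positivity
  linarith
end
end

section
/- Let b ∈ (0,1) with b² irrational, and let m, n ≥ 1 be integers. Set λ_{m,n} = 4π²(m² + n²/b²), and let k(m,n) = 1 + (the total weight of pairs (p,q) ∈ ℕ² with 4π²(p² + q²/b²) < λ_{m,n}), where each pair carries weight 1 if p = q = 0, weight 2 if exactly one of p,q is zero, and weight 4 if both are positive; thus k(m,n) is the minimal index k with λ_k = λ_{m,n} in the nondecreasing enumeration (with multiplicity) of the Laplace eigenvalues of T(1,b). Then every nonzero smooth function u : ℝ² → ℝ, periodic with periods (1,0) and (0,b) and satisfying Δu = −λ_{m,n}·u, has strictly fewer than k(m,n) nodal domains on the torus T(1,b). In other words, no eigenpair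 (u, λ_{m,n}) with m, n ≥ 1 is Courant sharp. -/
open Real

noncomputable section

/-- The Laplacian `Δu = ∂²u/∂x² + ∂²u/∂y²` of `u : ℝ² → ℝ` at `p`. -/
def lap (u : ℝ × ℝ → ℝ) (p : ℝ × ℝ) : ℝ :=
  fderiv ℝ (fun q => fderiv ℝ u q (1, 0)) p (1, 0)
    + fderiv ℝ (fun q => fderiv ℝ u q (0, 1)) p (0, 1)

/-- The multiplicity weight of a pair of frequencies `(p,q) ∈ ℕ²` for the Laplacian on a
torus: `1` if `p = q = 0`, `2` if exactly one of them is zero, `4` if both are positive. -/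
def eigWeight : ℕ × ℕ → ℕ := fun pq =>
  if pq.1 = 0 ∧ pq.2 = 0 then 1 else if pq.1 = 0 ∨ pq.2 = 0 then 2 else 4

/-- A continuous periodic function all of whose Fourier integrals vanish is zero. -/
theorem eq_zero_of_fourier_integrals_eq_zero {T : ℝ} (hT : 0 < T) {f : ℝ → ℂ}
    (hf : Continuous f) (hper : Function.Periodic f T)
    (h : ∀ k : ℤ, ∫ x in (0 : ℝ)..T, fourier k (x : AddCircle T) * f x = 0) (x : ℝ) :
    f x = 0 := by
  have : Fact (0 < T) := ⟨hT⟩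
  let F : C(AddCircle T, ℂ) := ⟨hper.lift, continuous_coinduced_dom.mpr hf⟩
  have hF : ∀ x : ℝ, F (x : AddCircle T) = f x := fun x => hper.lift_coe x
  have hc : fourierCoeff F = 0 := by
    funext k
    rw [fourierCoeff_eq_intervalIntegral F k 0]
    simp only [hF, zero_add, smul_eq_mul, h (-k), Pi.zero_apply, smul_zero]
  have hs : Summable (fourierCoeff F) := by
    rw [hc]
    exact summable_zero
  have := has_pointwise_sum_fourier_series_of_summable hs (x : AddCircle T)
  rw [hc, hF] at this
  simp only [Pi.zero_apply, zero_smul] at this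
  exact this.unique hasSum_zero

theorem continuous_fourier_coe (T : ℝ) (k : ℤ) :
    Continuous fun x : ℝ => fourier k (x : AddCircle T) :=
  (fourier k).continuous.comp (AddCircle.continuous_mk' T)

/-- Integrating by parts twice against a Fourier monomial. -/
theorem integral_fourier_mul_deriv_deriv {T : ℝ} (k : ℤ) {f f' f'' : ℝ → ℂ}
    (hf : ∀ x, HasDerivAt f (f' x) x) (hf' : ∀ x, HasDerivAt f' (f'' x) x)
    (hf'' : Continuous f'') (hper : Function.Periodic f T) (hper' : Function.Periodic f' T) :
    ∫ x in (0 : ℝ)..T, fourier k (x : AddCircle T) * f'' x =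
      -(2 * π * k / T) ^ 2 * ∫ x in (0 : ℝ)..T, fourier k (x : AddCircle T) * f x := by
  have hcf : Continuous f := continuous_iff_continuousAt.2 fun x => (hf x).continuousAt
  have hcf' : Continuous f' := continuous_iff_continuousAt.2 fun x => (hf' x).continuousAt
  have heT : fourier k ((T : ℝ) : AddCircle T) = fourier k ((0 : ℝ) : AddCircle T) := by
    rw [AddCircle.coe_period, QuotientAddGroup.mk_zero]
  have hfT : f T = f 0 := by simpa using hper 0
  have hfT' : f' T = f' 0 := by simpa using hper' 0
  have by_parts : ∀ g g' : ℝ → ℂ, (∀ x, HasDerivAt g (g' x) x) → Continuous g' → g T = g 0 →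
      ∫ x in (0 : ℝ)..T, fourier k (x : AddCircle T) * g' x =
        -(2 * π * Complex.I * k / T) * ∫ x in (0 : ℝ)..T, fourier k (x : AddCircle T) * g x := by
    intro g g' hg hg' hgT
    have hcg : Continuous g := continuous_iff_continuousAt.2 fun x => (hg x).continuousAt
    rw [intervalIntegral.integral_mul_deriv_eq_deriv_mul
      (fun x _ => hasDerivAt_fourier T k x) (fun x _ => hg x)
      ((continuous_const.mul (continuous_fourier_coe T k)).intervalIntegrable _ _)
      (hg'.intervalIntegrable _ _),
      heT, hgT, ← intervalIntegral.integral_const_mul, sub_self, zero_sub,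
      ← intervalIntegral.integral_neg]
    congr 1
    funext x
    ring
  rw [by_parts f' f'' hf' hf'' hfT', by_parts f f' hf hcf' hfT, ← mul_assoc]
  congr 1
  linear_combination (-(2 * π * k / T) ^ 2 : ℂ) * (-1) * Complex.I_sq

/-- The double Fourier integral of `h : ℝ² → ℂ` with periods `(1, 0)` and `(0, b)`. -/
def fourierIntegral₂ (b : ℝ) (p q : ℤ) (h : ℝ → ℝ → ℂ) : ℂ :=
  ∫ y in (0 : ℝ)..b, fourier q (y : AddCircle b) *
    ∫ x in (0 : ℝ)..1, fourier p (x : AddCircle (1 : ℝ)) * h x y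

theorem continuous_inner_fourierIntegral {T : ℝ} (k : ℤ) {h : ℝ → ℝ → ℂ}
    (hh : Continuous fun z : ℝ × ℝ => h z.1 z.2) :
    Continuous fun y => ∫ x in (0 : ℝ)..T, fourier k (x : AddCircle T) * h x y := by
  refine intervalIntegral.continuous_parametric_intervalIntegral_of_continuous' ?_ _ _
  exact ((continuous_fourier_coe T k).comp continuous_snd).mul
    (hh.comp (continuous_snd.prodMk continuous_fst))

theorem fourierIntegral₂_swap (b : ℝ) (p q : ℤ) {h : ℝ → ℝ → ℂ}
    (hh : Continuous fun z : ℝ × ℝ => h z.1 z.2) :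
    fourierIntegral₂ b p q h =
      ∫ x in (0 : ℝ)..1, fourier p (x : AddCircle (1 : ℝ)) *
        ∫ y in (0 : ℝ)..b, fourier q (y : AddCircle b) * h x y := by
  unfold fourierIntegral₂
  simp_rw [← intervalIntegral.integral_const_mul]
  rw [MeasureTheory.intervalIntegral_intervalIntegral_swap]
  · simp_rw [mul_left_comm]
  · have hc : Continuous (Function.uncurry fun y x : ℝ => fourier q (y : AddCircle b) *
        (fourier p (x : AddCircle (1 : ℝ)) * h x y)) :=
      ((continuous_fourier_coe b q).comp continuous_fst).mul
        (((continuous_fourier_coe 1 p).comp continuous_snd).mul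
          (hh.comp (continuous_snd.prodMk continuous_fst)))
    exact (hc.continuousOn.integrableOn_compact
      (isCompact_uIcc.prod isCompact_uIcc)).mono_set
      (Set.prod_mono Set.uIoc_subset_uIcc Set.uIoc_subset_uIcc)

theorem fourierIntegral₂_add (b : ℝ) (p q : ℤ) {g h : ℝ → ℝ → ℂ}
    (hg : Continuous fun z : ℝ × ℝ => g z.1 z.2) (hh : Continuous fun z : ℝ × ℝ => h z.1 z.2) :
    fourierIntegral₂ b p q (fun x y => g x y + h x y) =
      fourierIntegral₂ b p q g + fourierIntegral₂ b p q h := by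
  unfold fourierIntegral₂
  have inner : ∀ y, ∫ x in (0 : ℝ)..1, fourier p (x : AddCircle (1 : ℝ)) * (g x y + h x y) =
      (∫ x in (0 : ℝ)..1, fourier p (x : AddCircle (1 : ℝ)) * g x y) +
        ∫ x in (0 : ℝ)..1, fourier p (x : AddCircle (1 : ℝ)) * h x y := fun y => by
    simp_rw [mul_add]
    refine intervalIntegral.integral_add (Continuous.intervalIntegrable ?_ _ _)
      (Continuous.intervalIntegrable ?_ _ _)
    · exact (continuous_fourier_coe 1 p).mul (hg.comp (continuous_id.prodMk continuous_const))
    · exact (continuous_fourier_coe 1 p).mul (hh.comp (continuous_id.prodMk continuous_const))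
  simp_rw [inner, mul_add]
  refine intervalIntegral.integral_add (Continuous.intervalIntegrable ?_ _ _)
    (Continuous.intervalIntegrable ?_ _ _)
  · exact (continuous_fourier_coe b q).mul (continuous_inner_fourierIntegral p hg)
  · exact (continuous_fourier_coe b q).mul (continuous_inner_fourierIntegral p hh)

theorem fourierIntegral₂_const_mul (b : ℝ) (p q : ℤ) (c : ℂ) (h : ℝ → ℝ → ℂ) :
    fourierIntegral₂ b p q (fun x y => c * h x y) = c * fourierIntegral₂ b p q h := by
  unfold fourierIntegral₂
  simp_rw [mul_left_comm _ c, intervalIntegral.integral_const_mul, mul_left_comm _ c,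
    intervalIntegral.integral_const_mul]

theorem eq_zero_of_fourierIntegral₂_eq_zero {b : ℝ} (hb : 0 < b) {h : ℝ → ℝ → ℂ}
    (hh : Continuous fun z : ℝ × ℝ => h z.1 z.2)
    (hper1 : ∀ x y, h (x + 1) y = h x y) (hper2 : ∀ x y, h x (y + b) = h x y)
    (h0 : ∀ p q, fourierIntegral₂ b p q h = 0) (x y : ℝ) : h x y = 0 := by
  refine eq_zero_of_fourier_integrals_eq_zero one_pos (f := fun x => h x y)
    (hh.comp (continuous_id.prodMk continuous_const)) (fun x => hper1 x y) (fun p => ?_) x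
  refine eq_zero_of_fourier_integrals_eq_zero hb
    (f := fun y => ∫ x in (0 : ℝ)..1, fourier p (x : AddCircle (1 : ℝ)) * h x y)
    (continuous_inner_fourierIntegral p hh) (fun y => ?_) (fun q => h0 p q) y
  simp only [hper2]

/-- On an irrational torus, an eigenfunction for `4π²(m² + n²/b²)` is already an eigenfunction
of `∂²/∂x²`. -/
theorem deriv_deriv_eq_of_irrational {b : ℝ} (hb : 0 < b) (hirr : Irrational (b ^ 2)) (m n : ℕ)
    {u ux uxx uy uyy : ℝ → ℝ → ℂ}
    (hu : Continuous fun z : ℝ × ℝ => u z.1 z.2)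
    (huxx : Continuous fun z : ℝ × ℝ => uxx z.1 z.2)
    (huyy : Continuous fun z : ℝ × ℝ => uyy z.1 z.2)
    (hux' : ∀ x y, HasDerivAt (fun x => u x y) (ux x y) x)
    (huxx' : ∀ x y, HasDerivAt (fun x => ux x y) (uxx x y) x)
    (huy' : ∀ x y, HasDerivAt (fun y => u x y) (uy x y) y)
    (huyy' : ∀ x y, HasDerivAt (fun y => uy x y) (uyy x y) y)
    (hu1 : ∀ x y, u (x + 1) y = u x y) (hu2 : ∀ x y, u x (y + b) = u x y)
    (hux1 : ∀ x y, ux (x + 1) y = ux x y)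
    (huy2 : ∀ x y, uy x (y + b) = uy x y)
    (huxx1 : ∀ x y, uxx (x + 1) y = uxx x y) (huxx2 : ∀ x y, uxx x (y + b) = uxx x y)
    (heig : ∀ x y, uxx x y + uyy x y = -(4 * π ^ 2 * ((m : ℂ) ^ 2 + (n : ℂ) ^ 2 / b ^ 2)) * u x y)
    (x y : ℝ) : uxx x y + (4 * π ^ 2 * (m : ℂ) ^ 2) * u x y = 0 := by
  have hmu : Continuous fun z : ℝ × ℝ => (4 * π ^ 2 * (m : ℂ) ^ 2) * u z.1 z.2 :=
    continuous_const.mul hu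
  refine eq_zero_of_fourierIntegral₂_eq_zero hb
    (h := fun x y => uxx x y + (4 * π ^ 2 * (m : ℂ) ^ 2) * u x y)
    (huxx.add hmu) (fun x y => by simp only [huxx1, hu1])
    (fun x y => by simp only [huxx2, hu2]) (fun p q => ?_) x y
  have hcxx : fourierIntegral₂ b p q uxx =
      -(2 * π * p) ^ 2 * fourierIntegral₂ b p q u := by
    rw [← fourierIntegral₂_const_mul]
    unfold fourierIntegral₂
    congr 1
    funext y
    rw [integral_fourier_mul_deriv_deriv p (fun x => hux' x y) (fun x => huxx' x y)
      (huxx.comp (continuous_id.prodMk continuous_const)) (fun x => hu1 x y)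
      (fun x => hux1 x y)]
    simp_rw [mul_left_comm _ (-(2 * π * p : ℂ) ^ 2), intervalIntegral.integral_const_mul]
    simp
  have hcyy : fourierIntegral₂ b p q uyy =
      -(2 * π * q / b) ^ 2 * fourierIntegral₂ b p q u := by
    rw [fourierIntegral₂_swap b p q huyy, fourierIntegral₂_swap b p q hu,
      ← intervalIntegral.integral_const_mul]
    congr 1
    funext x
    rw [integral_fourier_mul_deriv_deriv q (fun y => huy' x y) (fun y => huyy' x y)
      (huyy.comp (continuous_const.prodMk continuous_id)) (fun y => hu2 x y)
      (fun y => huy2 x y)]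
    ring
  have hsum : fourierIntegral₂ b p q uxx + fourierIntegral₂ b p q uyy =
      -(4 * π ^ 2 * ((m : ℂ) ^ 2 + (n : ℂ) ^ 2 / b ^ 2)) * fourierIntegral₂ b p q u := by
    rw [← fourierIntegral₂_add b p q huxx huyy, ← fourierIntegral₂_const_mul]
    simp_rw [heig]
  rw [fourierIntegral₂_add b p q huxx hmu, fourierIntegral₂_const_mul, hcxx]
  rw [hcxx, hcyy] at hsum
  by_cases hc : fourierIntegral₂ b p q u = 0
  · simp [hc]
  have hb' : (b : ℂ) ≠ 0 := by exact_mod_cast hb.ne'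
  have hpi : (π : ℂ) ≠ 0 := by exact_mod_cast pi_ne_zero
  have key : ((m : ℂ) ^ 2 - p ^ 2) * b ^ 2 = q ^ 2 - n ^ 2 := by
    have h1 : -(2 * π * p : ℂ) ^ 2 + -(2 * π * q / b) ^ 2 =
        -(4 * π ^ 2 * ((m : ℂ) ^ 2 + (n : ℂ) ^ 2 / b ^ 2)) :=
      mul_right_cancel₀ hc (by linear_combination hsum)
    field_simp at h1
    linear_combination (1 / 4 : ℂ) * h1
  have key' : ((m : ℝ) ^ 2 - p ^ 2) * b ^ 2 = q ^ 2 - n ^ 2 := by exact_mod_cast key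
  have hmp : (m : ℝ) ^ 2 - p ^ 2 = 0 := by
    by_contra hne
    refine hirr ⟨((q : ℚ) ^ 2 - n ^ 2) / ((m : ℚ) ^ 2 - p ^ 2), ?_⟩
    push_cast
    rw [← key']
    field_simp
  have hmpC : (m : ℂ) ^ 2 - p ^ 2 = 0 := by exact_mod_cast hmp
  linear_combination (4 * π ^ 2 * fourierIntegral₂ b p q u) * hmpC

/-- Solutions of `f'' = -ω² f`. -/
theorem harmonic_oscillator {ω : ℝ} (hω : ω ≠ 0) {f f' : ℝ → ℝ}
    (hf : ∀ x, HasDerivAt f (f' x) x) (hf' : ∀ x, HasDerivAt f' (-ω ^ 2 * f x) x) (x : ℝ) :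
    f x = f 0 * cos (ω * x) + f' 0 / ω * sin (ω * x) := by
  have hl : ∀ x : ℝ, HasDerivAt (fun x => ω * x) ω x := fun x => by
    simpa using (hasDerivAt_id x).const_mul ω
  have h1 : ∀ x, HasDerivAt (fun x => f x * cos (ω * x) - f' x / ω * sin (ω * x)) 0 x := by
    intro x
    refine (((hf x).mul (hl x).cos).sub (((hf' x).div_const ω).mul (hl x).sin)).congr_deriv ?_
    field_simp
    ring
  have h2 : ∀ x, HasDerivAt (fun x => f x * sin (ω * x) + f' x / ω * cos (ω * x)) 0 x := by
    intro x
    refine (((hf x).mul (hl x).sin).add (((hf' x).div_const ω).mul (hl x).cos)).congr_deriv ?_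
    field_simp
    ring
  have e1 := is_const_of_deriv_eq_zero (fun x => (h1 x).differentiableAt)
    (fun x => (h1 x).deriv) x 0
  have e2 := is_const_of_deriv_eq_zero (fun x => (h2 x).differentiableAt)
    (fun x => (h2 x).deriv) x 0
  simp only [mul_zero, cos_zero, sin_zero, mul_one, sub_zero, zero_add] at e1 e2
  rw [← e1, ← e2]
  linear_combination (-f x) * sin_sq_add_cos_sq (ω * x)

theorem exists_amplitude_phase (X Y : ℝ) :
    ∃ R α : ℝ, 0 ≤ R ∧ ∀ t, X * cos t + Y * sin t = R * cos (t - α) := by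
  refine ⟨‖(⟨X, Y⟩ : ℂ)‖, Complex.arg ⟨X, Y⟩, norm_nonneg _, fun t => ?_⟩
  have h1 := Complex.norm_mul_cos_arg ⟨X, Y⟩
  have h2 := Complex.norm_mul_sin_arg ⟨X, Y⟩
  simp only at h1 h2
  rw [cos_sub]
  linear_combination (-cos t) * h1 - sin t * h2

theorem exists_sum_cos_form (A B C D : ℝ) :
    ∃ P Q θ₀ φ₀ : ℝ, 0 ≤ P ∧ 0 ≤ Q ∧ ∀ θ φ : ℝ,
      A * (cos θ * cos φ) + B * (cos θ * sin φ) + C * (sin θ * cos φ) + D * (sin θ * sin φ) =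
        P * cos ((θ - θ₀) + (φ - φ₀)) + Q * cos ((θ - θ₀) - (φ - φ₀)) := by
  obtain ⟨P, α, hP, h1⟩ := exists_amplitude_phase ((A - D) / 2) ((B + C) / 2)
  obtain ⟨Q, β, hQ, h2⟩ := exists_amplitude_phase ((A + D) / 2) ((C - B) / 2)
  refine ⟨P, Q, (α + β) / 2, (α - β) / 2, hP, hQ, fun θ φ => ?_⟩
  have e1 : θ - (α + β) / 2 + (φ - (α - β) / 2) = (θ + φ) - α := by ring
  have e2 : θ - (α + β) / 2 - (φ - (α - β) / 2) = (θ - φ) - β := by ring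
  rw [e1, e2, ← h1, ← h2, cos_add, sin_add, cos_sub, sin_sub]
  ring

/-- Moving straight towards a nearest maximum of the cosine does not decrease it. -/
theorem exists_cos_le_cos_lineMap (t : ℝ) :
    ∃ k : ℤ, ∀ r ∈ Set.Icc (0 : ℝ) 1, cos t ≤ cos (t + r * (2 * π * k - t)) := by
  refine ⟨round (t / (2 * π)), fun r hr => ?_⟩
  set k := round (t / (2 * π))
  have hk : |t - 2 * π * k| ≤ π := by
    have h := abs_sub_round (t / (2 * π))
    have e : t - 2 * π * k = 2 * π * (t / (2 * π) - k) := by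
      field_simp
    rw [e, abs_mul, abs_of_pos two_pi_pos]
    nlinarith [pi_pos]
  have e1 : cos t = cos |t - 2 * π * k| := by
    rw [cos_abs, ← cos_sub_int_mul_two_pi t k]
    congr 1
    ring
  have e2 : cos (t + r * (2 * π * k - t)) = cos ((1 - r) * |t - 2 * π * k|) := by
    have h := abs_mul (1 - r) (t - 2 * π * k)
    rw [abs_of_nonneg (sub_nonneg.2 hr.2)] at h
    rw [← h, cos_abs, ← cos_sub_int_mul_two_pi (t + _) k]
    congr 1
    ring
  rw [e1, e2]
  exact cos_le_cos_of_nonneg_of_le_pi (mul_nonneg (sub_nonneg.2 hr.2) (abs_nonneg _)) hk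
    (mul_le_of_le_one_left (abs_nonneg _) (by linarith [hr.1]))

theorem exists_segment_pos {P Q : ℝ} (hP : 0 ≤ P) (hQ : 0 ≤ Q) {θ φ : ℝ}
    (h : 0 < P * cos (θ + φ) + Q * cos (θ - φ)) :
    ∃ i j : ℤ, ∀ r ∈ Set.Icc (0 : ℝ) 1,
      0 < P * cos ((θ + r * (π * i - θ)) + (φ + r * (π * j - φ))) +
        Q * cos ((θ + r * (π * i - θ)) - (φ + r * (π * j - φ))) := by
  obtain ⟨k, hk⟩ := exists_cos_le_cos_lineMap (θ + φ)
  obtain ⟨l, hl⟩ := exists_cos_le_cos_lineMap (θ - φ)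
  refine ⟨k + l, k - l, fun r hr => h.trans_le ?_⟩
  have e1 : (θ + r * (π * ((k + l : ℤ) : ℝ) - θ)) + (φ + r * (π * ((k - l : ℤ) : ℝ) - φ)) =
      θ + φ + r * (2 * π * k - (θ + φ)) := by
    push_cast
    ring
  have e2 : (θ + r * (π * ((k + l : ℤ) : ℝ) - θ)) - (φ + r * (π * ((k - l : ℤ) : ℝ) - φ)) =
      θ - φ + r * (2 * π * l - (θ - φ)) := by
    push_cast
    ring
  rw [e1, e2]
  exact add_le_add (mul_le_mul_of_nonneg_left (hk r hr) hP)
    (mul_le_mul_of_nonneg_left (hl r hr) hQ)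

/-- Each point where `P cos (θ + φ) + Q cos (θ - φ)` does not vanish can be joined, by a segment on
which the function does not vanish, to a point of the lattice `(πℤ)²`. -/
theorem exists_segment_ne_zero {P Q : ℝ} (hP : 0 ≤ P) (hQ : 0 ≤ Q) {θ φ : ℝ}
    (h : P * cos (θ + φ) + Q * cos (θ - φ) ≠ 0) :
    ∃ i j : ℤ, ∀ r ∈ Set.Icc (0 : ℝ) 1,
      P * cos ((θ + r * (π * i - θ)) + (φ + r * (π * j - φ))) +
        Q * cos ((θ + r * (π * i - θ)) - (φ + r * (π * j - φ))) ≠ 0 := by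
  rcases h.lt_or_gt with h | h
  · have h' : 0 < P * cos ((θ + π) + φ) + Q * cos ((θ + π) - φ) := by
      rw [add_right_comm, add_sub_right_comm, cos_add_pi, cos_add_pi]
      linarith
    obtain ⟨i, j, hij⟩ := exists_segment_pos hP hQ h'
    refine ⟨i - 1, j, fun r hr => ne_of_lt ?_⟩
    have := hij r hr
    have e1 : θ + π + r * (π * i - (θ + π)) + (φ + r * (π * j - φ)) =
        (θ + r * (π * ((i - 1 : ℤ) : ℝ) - θ)) + (φ + r * (π * j - φ)) + π := by
      push_cast
      ring
    have e2 : θ + π + r * (π * i - (θ + π)) - (φ + r * (π * j - φ)) =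
        (θ + r * (π * ((i - 1 : ℤ) : ℝ) - θ)) - (φ + r * (π * j - φ)) + π := by
      push_cast
      ring
    rw [e1, e2, cos_add_pi, cos_add_pi] at this
    linarith
  · obtain ⟨i, j, hij⟩ := exists_segment_pos hP hQ h
    exact ⟨i, j, fun r hr => (hij r hr).ne'⟩

theorem coe_add_div_eq_emod (T c : ℝ) {N : ℕ} (hN : 0 < N) (i : ℤ) :
    ((c + T * i / N : ℝ) : AddCircle T) =
      ((c + T * ((i % N).toNat : ℕ) / N : ℝ) : AddCircle T) := by
  rw [← sub_eq_zero, ← AddCircle.coe_sub, AddCircle.coe_eq_zero_iff]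
  refine ⟨i / N, ?_⟩
  have hN' : (N : ℝ) ≠ 0 := by positivity
  have h1 : (((i % N).toNat : ℕ) : ℤ) = i % N := Int.toNat_of_nonneg (Int.emod_nonneg _ (by omega))
  have h2 : (((i % N).toNat : ℕ) : ℝ) = ((i % N : ℤ) : ℝ) := by exact_mod_cast h1
  have h3 : ((i % N : ℤ) : ℝ) + N * ((i / N : ℤ) : ℝ) = i := by
    exact_mod_cast Int.emod_add_mul_ediv i N
  rw [h2, ← h3, zsmul_eq_mul]
  field_simp
  ring

/-- A nonzero function `P cos (θ + φ) + Q cos (θ - φ)`, with `θ = 2πmx - θ₀` and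
`φ = 2πny/b - φ₀`, has at most `4mn` nodal domains on the torus. -/
theorem card_nodal_domains_le {b : ℝ} (hb : 0 < b) {m n : ℕ} (hm : 0 < m) (hn : 0 < n)
    {P Q θ₀ φ₀ : ℝ} (hP : 0 ≤ P) (hQ : 0 ≤ Q) (hPQ : P + Q ≠ 0)
    {v : AddCircle (1 : ℝ) × AddCircle b → ℝ}
    (hv : ∀ x y : ℝ, v ((x : AddCircle (1 : ℝ)), (y : AddCircle b)) =
      P * cos ((2 * π * m * x - θ₀) + (2 * π * n / b * y - φ₀)) +
        Q * cos ((2 * π * m * x - θ₀) - (2 * π * n / b * y - φ₀))) :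
    Finite (ConnectedComponents {z : AddCircle (1 : ℝ) × AddCircle b // v z ≠ 0}) ∧
      Nat.card (ConnectedComponents {z : AddCircle (1 : ℝ) × AddCircle b // v z ≠ 0}) ≤
        4 * (m * n) := by
  have hm' : (m : ℝ) ≠ 0 := by positivity
  have hn' : (n : ℝ) ≠ 0 := by positivity
  have hpi := pi_ne_zero
  set X : ℤ → ℝ := fun i => θ₀ / (2 * π * m) + 1 * i / (2 * m : ℕ) with hX
  set Y : ℤ → ℝ := fun j => φ₀ / (2 * π * n / b) + b * j / (2 * n : ℕ) with hY
  have hθ : ∀ i, 2 * π * m * X i - θ₀ = π * i := fun i => by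
    simp only [hX]
    push_cast
    field_simp
    ring
  have hφ : ∀ j, 2 * π * n / b * Y j - φ₀ = π * j := fun j => by
    simp only [hY]
    push_cast
    field_simp
    ring
  have hvXY : ∀ i j, v ((X i : AddCircle (1 : ℝ)), (Y j : AddCircle b)) ≠ 0 := by
    intro i j
    have hc : ∀ k : ℤ, sin (π * k) = 0 := fun k => by rw [mul_comm, sin_int_mul_pi]
    have hs : ∀ k : ℤ, cos (π * k) ≠ 0 := fun k h => by
      have := sin_sq_add_cos_sq (π * k)
      rw [hc, h] at this
      norm_num at this
    rw [hv, hθ, hφ, cos_add, cos_sub, hc i]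
    have : P * (cos (π * i) * cos (π * j) - 0 * sin (π * j)) +
        Q * (cos (π * i) * cos (π * j) + 0 * sin (π * j)) =
        (P + Q) * (cos (π * i) * cos (π * j)) := by ring
    rw [this]
    exact mul_ne_zero hPQ (mul_ne_zero (hs i) (hs j))
  let g : Fin (2 * m) × Fin (2 * n) →
      ConnectedComponents {z : AddCircle (1 : ℝ) × AddCircle b // v z ≠ 0} := fun ij =>
    ConnectedComponents.mk ⟨_, hvXY (ij.1 : ℕ) (ij.2 : ℕ)⟩
  have hg : Function.Surjective g := by
    intro c
    obtain ⟨⟨⟨zx, zy⟩, hz⟩, rfl⟩ := ConnectedComponents.surjective_coe c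
    obtain ⟨x, rfl⟩ := QuotientAddGroup.mk_surjective zx
    obtain ⟨y, rfl⟩ := QuotientAddGroup.mk_surjective zy
    have hz' := hz
    rw [hv] at hz'
    obtain ⟨i, j, hij⟩ := exists_segment_ne_zero hP hQ hz'
    have hne : ∀ r : unitInterval, v (((x + r * (X i - x) : ℝ) : AddCircle (1 : ℝ)),
        ((y + r * (Y j - y) : ℝ) : AddCircle b)) ≠ 0 := by
      intro r
      rw [hv]
      convert hij r r.2 using 6
      all_goals first
        | rw [← hθ i]; ring
        | rw [← hφ j]; ring
    let γ : unitInterval → {z : AddCircle (1 : ℝ) × AddCircle b // v z ≠ 0} := fun r =>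
      ⟨_, hne r⟩
    have hγ : Continuous γ := by
      refine Continuous.subtype_mk (Continuous.prodMk ?_ ?_) _
      · exact (AddCircle.continuous_mk' 1).comp (by fun_prop)
      · exact (AddCircle.continuous_mk' b).comp (by fun_prop)
    have h01 : ConnectedComponents.mk (γ 1) = ConnectedComponents.mk (γ 0) :=
      ConnectedComponents.coe_eq_coe'.2 <|
        (isPreconnected_range hγ).subset_connectedComponent ⟨0, rfl⟩ ⟨1, rfl⟩
    have hmod : ∀ (N : ℕ), 0 < N → ∀ k : ℤ, (k % N).toNat < N := fun N hN k => by
      have h1 := Int.emod_lt_of_pos k (by exact_mod_cast hN : (0 : ℤ) < N)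
      have h2 := Int.emod_nonneg k (by omega : (N : ℤ) ≠ 0)
      omega
    refine ⟨(⟨_, hmod (2 * m) (by positivity) i⟩, ⟨_, hmod (2 * n) (by positivity) j⟩), ?_⟩
    have hγ0 : γ 0 = ⟨((x : AddCircle (1 : ℝ)), (y : AddCircle b)), hz⟩ := by
      simp [γ]
    rw [← hγ0, ← h01]
    refine congrArg ConnectedComponents.mk (Subtype.ext (Prod.ext ?_ ?_))
    · have h : x + ((1 : unitInterval) : ℝ) * (X i - x) = X i := by simp
      simp only [γ, h]
      exact (coe_add_div_eq_emod 1 (θ₀ / (2 * π * m)) (N := 2 * m) (by positivity) i).symm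
    · have h : y + ((1 : unitInterval) : ℝ) * (Y j - y) = Y j := by simp
      simp only [γ, h]
      exact (coe_add_div_eq_emod b (φ₀ / (2 * π * n / b)) (N := 2 * n)
        (by positivity) j).symm
  refine ⟨Finite.of_surjective g hg, ?_⟩
  refine (Nat.card_le_card_of_surjective g hg).trans_eq ?_
  simp only [Nat.card_eq_fintype_card, Fintype.card_prod, Fintype.card_fin]
  ring

theorem eigWeight_eq (pq : ℕ × ℕ) :
    eigWeight pq = (if pq.1 = 0 then 1 else 2) * (if pq.2 = 0 then 1 else 2) := by
  unfold eigWeight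
  split_ifs <;> simp_all

theorem sum_range_weight (N : ℕ) :
    ∑ p ∈ Finset.range (N + 1), (if p = 0 then 1 else 2) = 2 * N + 1 := by
  rw [Finset.sum_range_succ']
  simp
  ring

theorem finite_frequencies {b : ℝ} (hb0 : 0 < b) (R : ℝ) :
    {pq : ℕ × ℕ | 4 * π ^ 2 * ((pq.1 : ℝ) ^ 2 + (pq.2 : ℝ) ^ 2 / b ^ 2) < R}.Finite := by
  have hR : ∀ c : ℝ, 0 < c → {p : ℕ | c * (p : ℝ) ^ 2 < R}.Finite := by
    intro c hc
    refine (Set.finite_Iio (⌈R / c⌉₊ + 1)).subset fun p hp => ?_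
    have h1 : (p : ℝ) ^ 2 < R / c := by
      rw [lt_div_iff₀ hc, mul_comm]
      exact hp
    have h2 : ((p ^ 2 : ℕ) : ℝ) < ⌈R / c⌉₊ := by
      push_cast
      exact h1.trans_le (Nat.le_ceil _)
    have h3 : p ^ 2 < ⌈R / c⌉₊ := by exact_mod_cast h2
    simp only [Set.mem_Iio]
    nlinarith
  refine ((hR (4 * π ^ 2) (by positivity)).prod
    (hR (4 * π ^ 2 / b ^ 2) (by positivity))).subset fun pq h => ?_
  have e : 4 * π ^ 2 * ((pq.1 : ℝ) ^ 2 + (pq.2 : ℝ) ^ 2 / b ^ 2) =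
      4 * π ^ 2 * (pq.1 : ℝ) ^ 2 + 4 * π ^ 2 / b ^ 2 * (pq.2 : ℝ) ^ 2 := by ring
  have h' : 4 * π ^ 2 * (pq.1 : ℝ) ^ 2 + 4 * π ^ 2 / b ^ 2 * (pq.2 : ℝ) ^ 2 < R := e ▸ h
  have p1 : 0 ≤ 4 * π ^ 2 * (pq.1 : ℝ) ^ 2 := by positivity
  have p2 : 0 ≤ 4 * π ^ 2 / b ^ 2 * (pq.2 : ℝ) ^ 2 := by positivity
  exact ⟨show _ < R by linarith, show _ < R by linarith⟩

/-- The eigenvalues below `4π²(m² + n²/b²)` have total multiplicity at least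
`(2m + 1)(2n + 1) - 4`. -/
theorem le_sum_eigWeight {b : ℝ} (hb0 : 0 < b) {m n : ℕ} (hm : 1 ≤ m) (hn : 1 ≤ n)
    {S : Finset (ℕ × ℕ)}
    (hS : ∀ pq, pq ∈ S ↔ 4 * π ^ 2 * ((pq.1 : ℝ) ^ 2 + (pq.2 : ℝ) ^ 2 / b ^ 2) <
      4 * π ^ 2 * ((m : ℝ) ^ 2 + (n : ℝ) ^ 2 / b ^ 2)) :
    (2 * m + 1) * (2 * n + 1) ≤ (∑ pq ∈ S, eigWeight pq) + 4 := by
  have hsub : (Finset.range (m + 1) ×ˢ Finset.range (n + 1)).erase (m, n) ⊆ S := by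
    intro pq hpq
    obtain ⟨p, q⟩ := pq
    simp only [Finset.mem_erase, Finset.mem_product, Finset.mem_range, ne_eq, Prod.mk.injEq]
      at hpq
    obtain ⟨hne, hp, hq⟩ := hpq
    rw [hS]
    have hp' : (p : ℝ) ^ 2 ≤ (m : ℝ) ^ 2 := by
      gcongr
      omega
    have hq' : (q : ℝ) ^ 2 / b ^ 2 ≤ (n : ℝ) ^ 2 / b ^ 2 := by
      gcongr
      omega
    have hpi : 0 < 4 * π ^ 2 := by positivity
    refine mul_lt_mul_of_pos_left ?_ hpi
    by_cases h : p = m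
    · refine add_lt_add_of_le_of_lt hp' ?_
      have : q < n := by omega
      gcongr
    · refine add_lt_add_of_lt_of_le ?_ hq'
      have : p < m := by omega
      gcongr
  have htot : ∑ pq ∈ Finset.range (m + 1) ×ˢ Finset.range (n + 1), eigWeight pq =
      (2 * m + 1) * (2 * n + 1) := by
    simp_rw [eigWeight_eq]
    rw [← sum_range_weight m, ← sum_range_weight n, Finset.sum_mul_sum, Finset.sum_product]
  have hw : eigWeight (m, n) = 4 := by
    rw [eigWeight_eq, if_neg (by simp; omega), if_neg (by simp; omega)]
  rw [← htot, ← Finset.sum_erase_add _ _ (show (m, n) ∈ _ by simp), hw]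
  exact Nat.add_le_add_right (Finset.sum_le_sum_of_subset hsub) 4

theorem hasDerivAt_slice_fst {u : ℝ × ℝ → ℝ} (hu : Differentiable ℝ u) (x y : ℝ) :
    HasDerivAt (fun x => u (x, y)) (fderiv ℝ u (x, y) (1, 0)) x :=
  (hu (x, y)).hasFDerivAt.comp_hasDerivAt x ((hasDerivAt_id x).prodMk (hasDerivAt_const x y))

theorem hasDerivAt_slice_snd {u : ℝ × ℝ → ℝ} (hu : Differentiable ℝ u) (x y : ℝ) :
    HasDerivAt (fun y => u (x, y)) (fderiv ℝ u (x, y) (0, 1)) y :=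
  (hu (x, y)).hasFDerivAt.comp_hasDerivAt y ((hasDerivAt_const y x).prodMk (hasDerivAt_id y))

theorem fderiv_apply_add_period {u : ℝ × ℝ → ℝ} {a : ℝ × ℝ} (h : ∀ p, u (p + a) = u p)
    (w p : ℝ × ℝ) : fderiv ℝ u (p + a) w = fderiv ℝ u p w := by
  rw [← fderiv_comp_add_right]
  simp only [h]

theorem contDiff_fderiv_apply {u : ℝ × ℝ → ℝ} (hu : ContDiff ℝ (⊤ : ℕ∞) u) (w : ℝ × ℝ) :
    ContDiff ℝ (⊤ : ℕ∞) fun q => fderiv ℝ u q w :=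
  (hu.fderiv_right (by simp)).clm_apply contDiff_const

/-- The eigenspace of `4π²(m² + n²/b²)` on an irrational torus is spanned by the products of
one-dimensional trigonometric functions of frequencies `m` and `n`. -/
theorem eigenfunction_eq {b : ℝ} (hb0 : 0 < b) (hirr : Irrational (b ^ 2)) {m n : ℕ} (hm : 1 ≤ m)
    (hn : 1 ≤ n) {u : ℝ × ℝ → ℝ} (hu : ContDiff ℝ (⊤ : ℕ∞) u)
    (hper1 : ∀ p : ℝ × ℝ, u (p.1 + 1, p.2) = u p)
    (hper2 : ∀ p : ℝ × ℝ, u (p.1, p.2 + b) = u p)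
    (heig : ∀ p : ℝ × ℝ,
      lap u p = -(4 * π ^ 2 * ((m : ℝ) ^ 2 + (n : ℝ) ^ 2 / b ^ 2)) * u p) :
    ∃ A B C D : ℝ, ∀ x y, u (x, y) =
      A * (cos (2 * π * m * x) * cos (2 * π * n / b * y)) +
      B * (cos (2 * π * m * x) * sin (2 * π * n / b * y)) +
      C * (sin (2 * π * m * x) * cos (2 * π * n / b * y)) +
      D * (sin (2 * π * m * x) * sin (2 * π * n / b * y)) := by
  have hm' : (m : ℝ) ≠ 0 := by positivity
  have hn' : (n : ℝ) ≠ 0 := by positivity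
  have hp1 : ∀ p, u (p + (1, 0)) = u p := fun p => by simpa [Prod.add_def] using hper1 p
  have hp2 : ∀ p, u (p + (0, b)) = u p := fun p => by simpa [Prod.add_def] using hper2 p
  have hux := contDiff_fderiv_apply hu (1, 0)
  have huy := contDiff_fderiv_apply hu (0, 1)
  have huxx := contDiff_fderiv_apply hux (1, 0)
  have huyy := contDiff_fderiv_apply huy (0, 1)
  have hx1 := fderiv_apply_add_period hp1 (1, 0)
  have hx2 := fderiv_apply_add_period hp2 (1, 0)
  have hy2 := fderiv_apply_add_period hp2 (0, 1)
  have hxx1 := fderiv_apply_add_period (u := fun q => fderiv ℝ u q (1, 0)) hx1 (1, 0)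
  have hxx2 := fderiv_apply_add_period (u := fun q => fderiv ℝ u q (1, 0)) hx2 (1, 0)
  have dux := hasDerivAt_slice_fst (hu.differentiable (by simp))
  have duy := hasDerivAt_slice_snd (hu.differentiable (by simp))
  have duxx := hasDerivAt_slice_fst (hux.differentiable (by simp))
  have duyy := hasDerivAt_slice_snd (huy.differentiable (by simp))
  unfold lap at heig
  set ux := fun q => fderiv ℝ u q (1, 0)
  set uy := fun q => fderiv ℝ u q (0, 1)
  set uxx := fun q => fderiv ℝ ux q (1, 0)
  set uyy := fun q => fderiv ℝ uy q (0, 1)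
  have hxx : ∀ x y, uxx (x, y) = -(2 * π * m) ^ 2 * u (x, y) := by
    intro x y
    have h := deriv_deriv_eq_of_irrational hb0 hirr m n
      (u := fun x y => (u (x, y) : ℂ)) (ux := fun x y => (ux (x, y) : ℂ))
      (uxx := fun x y => (uxx (x, y) : ℂ)) (uy := fun x y => (uy (x, y) : ℂ))
      (uyy := fun x y => (uyy (x, y) : ℂ))
      (Complex.continuous_ofReal.comp hu.continuous)
      (Complex.continuous_ofReal.comp huxx.continuous)
      (Complex.continuous_ofReal.comp huyy.continuous)
      (fun x y => (dux x y).ofReal_comp) (fun x y => (duxx x y).ofReal_comp)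
      (fun x y => (duy x y).ofReal_comp) (fun x y => (duyy x y).ofReal_comp)
      (fun x y => by simpa using hp1 (x, y)) (fun x y => by simpa using hp2 (x, y))
      (fun x y => by simpa using hx1 (x, y)) (fun x y => by simpa using hy2 (x, y))
      (fun x y => by simpa using hxx1 (x, y)) (fun x y => by simpa using hxx2 (x, y))
      (fun x y => by exact_mod_cast heig (x, y)) x y
    have h' : uxx (x, y) + (4 * π ^ 2 * (m : ℝ) ^ 2) * u (x, y) = 0 := by exact_mod_cast h
    linear_combination h'
  have hyy : ∀ x y, uyy (x, y) = -(2 * π * n / b) ^ 2 * u (x, y) := by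
    intro x y
    have h : uxx (x, y) + uyy (x, y) = _ := heig (x, y)
    rw [hxx] at h
    linear_combination h
  have hωx : 2 * π * m ≠ 0 := by positivity
  have hωy : 2 * π * n / b ≠ 0 := by positivity
  have sx : ∀ x y, u (x, y) = u (0, y) * cos (2 * π * m * x) +
      ux (0, y) / (2 * π * m) * sin (2 * π * m * x) := fun x y =>
    harmonic_oscillator hωx (fun x => dux x y) (fun x => hxx x y ▸ duxx x y) x
  have sy : ∀ x y, u (x, y) = u (x, 0) * cos (2 * π * n / b * y) +
      uy (x, 0) / (2 * π * n / b) * sin (2 * π * n / b * y) := fun x y =>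
    harmonic_oscillator hωy (fun y => duy x y) (fun y => hyy x y ▸ duyy x y) y
  have sx' : ∀ y, ux (0, y) / (2 * π * m) = u (1 / (4 * m), y) := fun y => by
    have e : 2 * π * m * (1 / (4 * m)) = π / 2 := by
      field_simp
      norm_num
    rw [sx (1 / (4 * m)) y, e, cos_pi_div_two, sin_pi_div_two]
    ring
  refine ⟨u (0, 0), uy (0, 0) / (2 * π * n / b), u (1 / (4 * m), 0),
    uy (1 / (4 * m), 0) / (2 * π * n / b), fun x y => ?_⟩
  rw [sx, sx', sy 0 y, sy (1 / (4 * m)) y]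
  ring

/-- Let `b ∈ (0,1)` with `b²` irrational, `m, n ≥ 1`, and
`λ_{m,n} = 4π²(m² + n²/b²)`. Let `k(m,n) = 1 + Σ eigWeight (p,q)` over the pairs with
`4π²(p² + q²/b²) < λ_{m,n}`, the minimal index of `λ_{m,n}` in the nondecreasing
enumeration (with multiplicity) of eigenvalues of `T(1,b)`. Then every nonzero smooth
`u : ℝ² → ℝ`, periodic with periods `(1,0)` and `(0,b)` and satisfying
`Δu = -λ_{m,n} u`, has strictly fewer than `k(m,n)` nodal domains on the torus `T(1,b)`:
no eigenpair `(u, λ_{m,n})` with `m, n ≥ 1` is Courant sharp. -/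
theorem statement13 (b : ℝ) (hb0 : 0 < b) (hb1 : b < 1) (hirr : Irrational (b ^ 2))
    (m n : ℕ) (hm : 1 ≤ m) (hn : 1 ≤ n)
    (u : ℝ × ℝ → ℝ) (hu : ContDiff ℝ (⊤ : ℕ∞) u) (hu0 : u ≠ 0)
    (hper1 : ∀ p : ℝ × ℝ, u (p.1 + 1, p.2) = u p)
    (hper2 : ∀ p : ℝ × ℝ, u (p.1, p.2 + b) = u p)
    (heig : ∀ p : ℝ × ℝ,
      lap u p = -(4 * π ^ 2 * ((m : ℝ) ^ 2 + (n : ℝ) ^ 2 / b ^ 2)) * u p) :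
    ∃ hS : {pq : ℕ × ℕ |
        4 * π ^ 2 * (((pq.1 : ℝ)) ^ 2 + ((pq.2 : ℝ)) ^ 2 / b ^ 2) <
          4 * π ^ 2 * ((m : ℝ) ^ 2 + (n : ℝ) ^ 2 / b ^ 2)}.Finite,
      ∀ v : AddCircle (1 : ℝ) × AddCircle b → ℝ,
        (∀ x y : ℝ, v ((x : AddCircle (1 : ℝ)), (y : AddCircle b)) = u (x, y)) →
        Finite (ConnectedComponents {z : AddCircle (1 : ℝ) × AddCircle b // v z ≠ 0}) ∧
        Nat.card (ConnectedComponents {z : AddCircle (1 : ℝ) × AddCircle b // v z ≠ 0})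
          < 1 + ∑ pq ∈ hS.toFinset, eigWeight pq := by
  refine ⟨finite_frequencies hb0 _, fun v hv => ?_⟩
  obtain ⟨A, B, C, D, hABCD⟩ := eigenfunction_eq hb0 hirr hm hn hu hper1 hper2 heig
  obtain ⟨P, Q, θ₀, φ₀, hP, hQ, hform⟩ := exists_sum_cos_form A B C D
  have hPQ : P + Q ≠ 0 := by
    intro h
    have hP0 : P = 0 := by linarith
    have hQ0 : Q = 0 := by linarith
    refine hu0 (funext fun p => ?_)
    rw [← Prod.mk.eta (p := p), hABCD, hform, hP0, hQ0]
    simp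
  obtain ⟨hfin, hcard⟩ := card_nodal_domains_le hb0 hm hn hP hQ hPQ (v := v)
    (fun x y => by rw [hv, hABCD, hform])
  refine ⟨hfin, ?_⟩
  have hsum := le_sum_eigWeight hb0 hm hn
    (S := (finite_frequencies hb0
      (4 * π ^ 2 * ((m : ℝ) ^ 2 + (n : ℝ) ^ 2 / b ^ 2))).toFinset) (fun pq => by simp)
  refine hcard.trans_lt ?_
  have : (2 * m + 1) * (2 * n + 1) = 4 * (m * n) + 2 * m + 2 * n + 1 := by ring
  omega
end
end
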